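/- Let 1 < p < ∞ and t ∈ (0,1). The generalized Cesàro operator C_t on the Hardy space H^p satisfies ‖C_t f‖_p ≤ [ (1/(t(p−1)))·( (1−t)^{−(p−1)} − 1 ) ]^{1/p} · ‖f‖_p for all f ∈ H^p; in particular ‖C_t‖_{H^p→H^p} ≤ [ (1/(t(p−1)))·( (1−t)^{−(p−1)} − 1 ) ]^{1/p}. -/

import Mathlib

open Complex MeasureTheory Metric Set Filter Topology

/-- The generalized Cesàro operator `C_t`, given by
`(C_t f)(z) = ∫_0^1 f(sz)/(1 - s t z) ds`, which equals `f(0)` at `z = 0` and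
`(1/z)∫_0^z f(ξ)/(1 - tξ) dξ` for `z ≠ 0`. -/
noncomputable def cesaro (t : ℝ) (f : ℂ → ℂ) (z : ℂ) : ℂ :=
  ∫ s in (0:ℝ)..1, f ((s : ℂ) * z) / (1 - (s : ℂ) * (t : ℂ) * z)

/-- The integral means `M_p(r, f)`. -/
noncomputable def Mp (p : ℝ) (r : ℝ) (f : ℂ → ℂ) : ℝ :=
  ((1 / (2 * Real.pi)) *
    ∫ θ in (0:ℝ)..(2 * Real.pi), ‖f ((r : ℂ) * Complex.exp ((θ : ℂ) * Complex.I))‖ ^ p) ^ (1 / p)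

/-- The Hardy space norm `‖f‖_p = sup_{0 ≤ r < 1} M_p(r, f)`. -/
noncomputable def hardyNorm (p : ℝ) (f : ℂ → ℂ) : ℝ :=
  sSup ((fun r => Mp p r f) '' Set.Ico (0:ℝ) 1)

/-- Membership in the Hardy space `H^p`: holomorphic on the unit disc with bounded
integral means. -/
def MemHp (p : ℝ) (f : ℂ → ℂ) : Prop :=
  DifferentiableOn ℂ f (Metric.ball (0:ℂ) 1) ∧
    BddAbove ((fun r => Mp p r f) '' Set.Ico (0:ℝ) 1)

/-- The integrand of the Cesàro operator is controlled on the unit disc by `1 - s t`. -/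
lemma one_sub_le_norm_one_sub_mul {s t : ℝ} {z : ℂ} (hs : 0 ≤ s) (ht : 0 ≤ t) (hz : ‖z‖ ≤ 1) :
    1 - t * s ≤ ‖1 - (s : ℂ) * (t : ℂ) * z‖ := by
  have h := norm_sub_norm_le (1 : ℂ) ((s : ℂ) * (t : ℂ) * z)
  simp only [norm_one, norm_mul, Complex.norm_real, Real.norm_eq_abs, abs_of_nonneg hs,
    abs_of_nonneg ht] at h
  nlinarith [mul_nonneg hs ht]

lemma ofReal_mul_mem_ball {s : ℝ} {z : ℂ} (hs : s ∈ Icc (0 : ℝ) 1) (hz : z ∈ ball (0 : ℂ) 1) :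
    (s : ℂ) * z ∈ ball (0 : ℂ) 1 := by
  rw [mem_ball_zero_iff] at hz ⊢
  rw [norm_mul, Complex.norm_real, Real.norm_eq_abs, abs_of_nonneg hs.1]
  nlinarith [hs.1, hs.2, norm_nonneg z]

lemma one_sub_mul_pos {s t : ℝ} (hs : s ∈ Icc (0 : ℝ) 1) (ht0 : 0 ≤ t) (ht1 : t < 1) :
    0 < 1 - t * s := by
  nlinarith [hs.1, hs.2]

/-- The Cesàro transform is the difference quotient at `0` of a primitive of `f(z) / (1 - t z)`. -/
lemma differentiableOn_cesaro {t : ℝ} {f : ℂ → ℂ} (ht0 : 0 ≤ t) (ht1 : t < 1)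
    (hf : DifferentiableOn ℂ f (ball 0 1)) : DifferentiableOn ℂ (cesaro t f) (ball 0 1) := by
  have hne : ∀ z ∈ ball (0 : ℂ) 1, 1 - (t : ℂ) * z ≠ 0 := by
    intro z hz
    have h := one_sub_le_norm_one_sub_mul (s := 1) zero_le_one ht0 (mem_ball_zero_iff.1 hz).le
    rw [Complex.ofReal_one, one_mul] at h
    exact norm_pos_iff.1 (by linarith)
  have hg : DifferentiableOn ℂ (fun z => f z / (1 - (t : ℂ) * z)) (ball 0 1) :=
    hf.div (by fun_prop) hne
  obtain ⟨F, hF⟩ := hg.isExactOn_ball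
  have hF' : DifferentiableOn ℂ F (ball 0 1) :=
    fun z hz => (hF z hz).differentiableAt.differentiableWithinAt
  have h0 : (0 : ℂ) ∈ ball (0 : ℂ) 1 := mem_ball_self one_pos
  refine ((Complex.differentiableOn_dslope (isOpen_ball.mem_nhds h0)).2 hF').congr ?_
  intro z hz
  rcases eq_or_ne z 0 with rfl | hz0
  · simp [cesaro, dslope_same, (hF 0 h0).deriv]
  · have hderiv : ∀ s ∈ uIcc (0 : ℝ) 1, HasDerivAt (fun s : ℝ => F ((s : ℂ) * z))
        (f ((s : ℂ) * z) / (1 - (t : ℂ) * ((s : ℂ) * z)) * z) s := by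
      intro s hs
      rw [uIcc_of_le zero_le_one] at hs
      have h1 : HasDerivAt (fun s : ℝ => (s : ℂ) * z) z s := by
        simpa using (Complex.ofRealCLM.hasDerivAt (x := s)).mul_const z
      exact (hF _ (ofReal_mul_mem_ball hs hz)).comp s h1
    have hcont : ContinuousOn
        (fun s : ℝ => f ((s : ℂ) * z) / (1 - (t : ℂ) * ((s : ℂ) * z)) * z) (uIcc 0 1) := by
      rw [uIcc_of_le zero_le_one]
      exact (hg.continuousOn.comp (f := fun s : ℝ => (s : ℂ) * z) (by fun_prop)
        fun s hs => ofReal_mul_mem_ball hs hz).mul continuousOn_const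
    have hint := intervalIntegral.integral_eq_sub_of_hasDerivAt hderiv hcont.intervalIntegrable
    rw [intervalIntegral.integral_mul_const] at hint
    rw [dslope_of_ne _ hz0, slope_def_field, sub_zero, eq_div_iff hz0, cesaro]
    simpa [mul_assoc, mul_comm, mul_left_comm] using hint

/-- Jensen's inequality on the unit interval. -/
lemma norm_intervalIntegral_rpow_le {p : ℝ} (hp : 1 ≤ p) {g : ℝ → ℂ}
    (hg : ContinuousOn g (Icc 0 1)) :
    ‖∫ s in (0:ℝ)..1, g s‖ ^ p ≤ ∫ s in (0:ℝ)..1, ‖g s‖ ^ p := by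
  have hp0 : 0 ≤ p := by linarith
  have hI : ∀ {h : ℝ → ℝ}, ContinuousOn h (Icc 0 1) → IntegrableOn h (Ioc 0 1) :=
    fun h => (h.integrableOn_compact isCompact_Icc).mono_set Ioc_subset_Icc_self
  have : IsProbabilityMeasure (volume.restrict (Ioc (0 : ℝ) 1)) := ⟨by simp⟩
  calc ‖∫ s in (0:ℝ)..1, g s‖ ^ p ≤ (∫ s in (0:ℝ)..1, ‖g s‖) ^ p :=
        Real.rpow_le_rpow (norm_nonneg _)
          (intervalIntegral.norm_integral_le_integral_norm zero_le_one) hp0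
    _ ≤ ∫ s in (0:ℝ)..1, ‖g s‖ ^ p := by
        rw [intervalIntegral.integral_of_le zero_le_one, intervalIntegral.integral_of_le zero_le_one]
        exact (convexOn_rpow hp).map_integral_le
          (continuousOn_id.rpow_const fun _ _ => Or.inr hp0) isClosed_Ici
          (Eventually.of_forall fun s => norm_nonneg (g s)) (hI hg.norm)
          (hI (hg.norm.rpow_const fun _ _ => Or.inr hp0))

lemma integral_one_sub_mul_rpow {p t : ℝ} (hp : 1 < p) (ht0 : 0 < t) (ht1 : t < 1) :
    ∫ s in (0:ℝ)..1, (1 - t * s) ^ (-p) =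
      (1 / (t * (p - 1))) * ((1 - t) ^ (-(p - 1)) - 1) := by
  have hp' : p - 1 ≠ 0 := by linarith
  have hp'' : -p + 1 ≠ 0 := by linarith
  rw [intervalIntegral.integral_comp_sub_mul (fun x => x ^ (-p)) ht0.ne' 1, integral_rpow]
  · rw [mul_one, mul_zero, sub_zero, Real.one_rpow, smul_eq_mul,
      show -(p - 1) = -p + 1 by ring, show p - 1 = -(-p + 1) by ring]
    field_simp
    ring
  · right
    refine ⟨by linarith, ?_⟩
    rw [mul_one, mul_zero, sub_zero, uIcc_of_le (by linarith)]
    exact fun h => by linarith [h.1]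

lemma circle_mem_ball {r : ℝ} (hr : r ∈ Ico (0 : ℝ) 1) (θ : ℝ) :
    (r : ℂ) * Complex.exp ((θ : ℂ) * Complex.I) ∈ ball (0 : ℂ) 1 := by
  rw [mem_ball_zero_iff, norm_mul, Complex.norm_exp_ofReal_mul_I, mul_one, Complex.norm_real,
    Real.norm_eq_abs, abs_of_nonneg hr.1]
  exact hr.2

lemma continuous_norm_circle_rpow {p r : ℝ} (hp : 0 ≤ p) (hr : r ∈ Ico (0 : ℝ) 1) {f : ℂ → ℂ}
    (hf : ContinuousOn f (ball 0 1)) :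
    Continuous fun θ : ℝ => ‖f ((r : ℂ) * Complex.exp ((θ : ℂ) * Complex.I))‖ ^ p :=
  (hf.comp_continuous (by fun_prop) (circle_mem_ball hr)).norm.rpow_const fun _ => Or.inr hp

lemma circle_integral_nonneg (p r : ℝ) (f : ℂ → ℂ) :
    0 ≤ ∫ θ in (0:ℝ)..(2 * Real.pi),
      ‖f ((r : ℂ) * Complex.exp ((θ : ℂ) * Complex.I))‖ ^ p :=
  intervalIntegral.integral_nonneg Real.two_pi_pos.le fun _ _ =>
    Real.rpow_nonneg (norm_nonneg _) _

lemma Mp_nonneg (p r : ℝ) (f : ℂ → ℂ) : 0 ≤ Mp p r f :=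
  Real.rpow_nonneg (mul_nonneg (by positivity) (circle_integral_nonneg p r f)) _

lemma hardyNorm_nonneg (p : ℝ) (f : ℂ → ℂ) : 0 ≤ hardyNorm p f :=
  Real.sSup_nonneg (by rintro _ ⟨r, -, rfl⟩; exact Mp_nonneg p r f)

lemma circle_integral_le_hardyNorm {p r : ℝ} (hp : 0 < p) {f : ℂ → ℂ} (hf : MemHp p f)
    (hr : r ∈ Ico (0 : ℝ) 1) :
    ∫ θ in (0:ℝ)..(2 * Real.pi), ‖f ((r : ℂ) * Complex.exp ((θ : ℂ) * Complex.I))‖ ^ p ≤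
      2 * Real.pi * hardyNorm p f ^ p := by
  have h : Mp p r f ≤ hardyNorm p f := le_csSup hf.2 (mem_image_of_mem _ hr)
  have h' := Real.rpow_le_rpow (Mp_nonneg p r f) h hp.le
  rw [Mp, one_div p, Real.rpow_inv_rpow
    (mul_nonneg (by positivity) (circle_integral_nonneg p r f)) hp.ne', one_div,
    inv_mul_le_iff₀ Real.two_pi_pos] at h'
  exact h'

/-- Pointwise form of Jensen's inequality for the Cesàro transform. -/
lemma norm_cesaro_rpow_le {p t : ℝ} (hp : 1 ≤ p) (ht0 : 0 ≤ t) (ht1 : t < 1) {f : ℂ → ℂ}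
    (hf : ContinuousOn f (ball 0 1)) {z : ℂ} (hz : z ∈ ball (0 : ℂ) 1) :
    ‖cesaro t f z‖ ^ p ≤ ∫ s in (0:ℝ)..1, (1 - t * s) ^ (-p) * ‖f ((s : ℂ) * z)‖ ^ p := by
  have hp0 : 0 ≤ p := by linarith
  have hz' := (mem_ball_zero_iff.1 hz).le
  have hfz : ContinuousOn (fun s : ℝ => f ((s : ℂ) * z)) (Icc 0 1) :=
    hf.comp (by fun_prop) fun s hs => ofReal_mul_mem_ball hs hz
  have hden : ∀ s ∈ Icc (0 : ℝ) 1, 0 < ‖1 - (s : ℂ) * (t : ℂ) * z‖ := fun s hs =>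
    (one_sub_mul_pos hs ht0 ht1).trans_le (one_sub_le_norm_one_sub_mul hs.1 ht0 hz')
  have hg : ContinuousOn (fun s : ℝ => f ((s : ℂ) * z) / (1 - (s : ℂ) * (t : ℂ) * z)) (Icc 0 1) :=
    hfz.div (by fun_prop) fun s hs => norm_pos_iff.1 (hden s hs)
  refine (norm_intervalIntegral_rpow_le hp hg).trans ?_
  refine intervalIntegral.integral_mono_on zero_le_one ?_ ?_ ?_
  · refine ContinuousOn.intervalIntegrable ?_
    rw [uIcc_of_le zero_le_one]
    exact hg.norm.rpow_const fun _ _ => Or.inr hp0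
  · refine ContinuousOn.intervalIntegrable ?_
    rw [uIcc_of_le zero_le_one]
    exact (ContinuousOn.rpow_const (by fun_prop)
      fun s hs => Or.inl (one_sub_mul_pos hs ht0 ht1).ne').mul
      (hfz.norm.rpow_const fun _ _ => Or.inr hp0)
  · intro s hs
    rw [norm_div, Real.div_rpow (norm_nonneg _) (norm_nonneg _), div_eq_mul_inv, mul_comm,
      Real.rpow_neg (one_sub_mul_pos hs ht0 ht1).le]
    have := one_sub_mul_pos hs ht0 ht1
    gcongr
    exact one_sub_le_norm_one_sub_mul hs.1 ht0 hz'

lemma circle_integral_cesaro_le {p t r : ℝ} (hp : 1 < p) (ht0 : 0 < t) (ht1 : t < 1) {f : ℂ → ℂ}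
    (hf : MemHp p f) (hr : r ∈ Ico (0 : ℝ) 1) :
    ∫ θ in (0:ℝ)..(2 * Real.pi),
      ‖cesaro t f ((r : ℂ) * Complex.exp ((θ : ℂ) * Complex.I))‖ ^ p ≤
      (∫ s in (0:ℝ)..1, (1 - t * s) ^ (-p)) * (2 * Real.pi * hardyNorm p f ^ p) := by
  have hp0 : 0 ≤ p := by linarith
  have hfc := hf.1.continuousOn
  let G : ℝ → ℝ → ℝ := fun s θ =>
    (1 - t * s) ^ (-p) * ‖f ((s : ℂ) * ((r : ℂ) * Complex.exp ((θ : ℂ) * Complex.I)))‖ ^ p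
  have hG : ContinuousOn (Function.uncurry G) (Icc 0 1 ×ˢ Icc 0 (2 * Real.pi)) := by
    refine (ContinuousOn.rpow_const (by fun_prop)
      fun x hx => Or.inl (one_sub_mul_pos hx.1 ht0.le ht1).ne').mul
      (ContinuousOn.rpow_const (ContinuousOn.norm ?_) fun _ _ => Or.inr hp0)
    exact hfc.comp (by fun_prop) fun x hx => ofReal_mul_mem_ball hx.1 (circle_mem_ball hr x.2)
  have hGi : Integrable (Function.uncurry G) ((volume.restrict (Ioc 0 1)).prod
      (volume.restrict (Ioc 0 (2 * Real.pi)))) := by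
    rw [Measure.prod_restrict]
    exact (hG.integrableOn_compact (isCompact_Icc.prod isCompact_Icc)).mono_set
      (prod_mono Ioc_subset_Icc_self Ioc_subset_Icc_self)
  have hw : ContinuousOn (fun s : ℝ => (1 - t * s) ^ (-p)) (Icc 0 1) :=
    ContinuousOn.rpow_const (by fun_prop) fun s hs => Or.inl (one_sub_mul_pos hs ht0.le ht1).ne'
  calc ∫ θ in (0:ℝ)..(2 * Real.pi),
        ‖cesaro t f ((r : ℂ) * Complex.exp ((θ : ℂ) * Complex.I))‖ ^ p
      ≤ ∫ θ in (0:ℝ)..(2 * Real.pi), ∫ s in (0:ℝ)..1, G s θ := by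
        refine intervalIntegral.integral_mono_on Real.two_pi_pos.le ?_ ?_ fun θ _ =>
          norm_cesaro_rpow_le hp.le ht0.le ht1 hfc (circle_mem_ball hr θ)
        · exact (continuous_norm_circle_rpow hp0 hr
            (differentiableOn_cesaro ht0.le ht1 hf.1).continuousOn).intervalIntegrable _ _
        · simp_rw [intervalIntegral.integral_of_le zero_le_one]
          rw [intervalIntegrable_iff_integrableOn_Ioc_of_le Real.two_pi_pos.le]
          exact hGi.integral_prod_right
    _ = ∫ s in (0:ℝ)..1, ∫ θ in (0:ℝ)..(2 * Real.pi), G s θ := by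
        simp_rw [intervalIntegral.integral_of_le zero_le_one,
          intervalIntegral.integral_of_le Real.two_pi_pos.le]
        exact (integral_integral_swap hGi).symm
    _ ≤ ∫ s in (0:ℝ)..1, (1 - t * s) ^ (-p) * (2 * Real.pi * hardyNorm p f ^ p) := by
        refine intervalIntegral.integral_mono_on zero_le_one ?_ ?_ ?_
        · simp_rw [intervalIntegral.integral_of_le Real.two_pi_pos.le]
          rw [intervalIntegrable_iff_integrableOn_Ioc_of_le zero_le_one]
          exact hGi.integral_prod_left
        · refine ContinuousOn.intervalIntegrable ?_
          rw [uIcc_of_le zero_le_one]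
          exact hw.mul continuousOn_const
        · intro s hs
          have hsr : s * r ∈ Ico (0 : ℝ) 1 :=
            ⟨mul_nonneg hs.1 hr.1, by nlinarith [hs.1, hs.2, hr.1, hr.2]⟩
          have h := circle_integral_le_hardyNorm (by linarith) hf hsr
          simp only [G, intervalIntegral.integral_const_mul]
          refine mul_le_mul_of_nonneg_left ?_
            (Real.rpow_nonneg (one_sub_mul_pos hs ht0.le ht1).le _)
          simpa only [Complex.ofReal_mul, mul_assoc] using h
    _ = _ := intervalIntegral.integral_mul_const _ _

lemma Mp_cesaro_le {p t r : ℝ} (hp : 1 < p) (ht0 : 0 < t) (ht1 : t < 1) {f : ℂ → ℂ}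
    (hf : MemHp p f) (hr : r ∈ Ico (0 : ℝ) 1) :
    Mp p r (cesaro t f) ≤
      ((1 / (t * (p - 1))) * ((1 - t) ^ (-(p - 1)) - 1)) ^ (1 / p) * hardyNorm p f := by
  have hp0 : 0 < p := by linarith
  have hN := hardyNorm_nonneg p f
  rw [← integral_one_sub_mul_rpow hp ht0 ht1]
  have hK : 0 ≤ ∫ s in (0:ℝ)..1, (1 - t * s) ^ (-p) :=
    intervalIntegral.integral_nonneg zero_le_one fun s hs =>
      Real.rpow_nonneg (one_sub_mul_pos hs ht0.le ht1).le _
  calc Mp p r (cesaro t f)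
      ≤ ((∫ s in (0:ℝ)..1, (1 - t * s) ^ (-p)) * hardyNorm p f ^ p) ^ (1 / p) := by
        refine Real.rpow_le_rpow
          (mul_nonneg (by positivity) (circle_integral_nonneg p r _)) ?_ (by positivity)
        rw [one_div, inv_mul_le_iff₀ Real.two_pi_pos]
        exact (circle_integral_cesaro_le hp ht0 ht1 hf hr).trans_eq (by ring)
    _ = _ := by
        rw [Real.mul_rpow hK (Real.rpow_nonneg hN _), one_div, Real.rpow_rpow_inv hN hp0.ne']

/-- For `1 < p < ∞` and `t ∈ (0,1)`, the operator `C_t` on `H^p` satisfies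
`‖C_t f‖_p ≤ [ (1/(t(p-1)))((1-t)^{-(p-1)} - 1) ]^{1/p} ‖f‖_p` for all `f ∈ H^p`. -/
theorem cesaro_Hp_norm_estimate (p t : ℝ) (hp : 1 < p) (ht0 : 0 < t) (ht1 : t < 1) :
    ∀ f, MemHp p f →
      MemHp p (cesaro t f) ∧
      hardyNorm p (cesaro t f) ≤
        ((1 / (t * (p - 1))) * ((1 - t) ^ (-(p - 1)) - 1)) ^ (1 / p) * hardyNorm p f := by
  intro f hf
  have hle : ∀ x ∈ (fun r => Mp p r (cesaro t f)) '' Set.Ico (0:ℝ) 1, x ≤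
      ((1 / (t * (p - 1))) * ((1 - t) ^ (-(p - 1)) - 1)) ^ (1 / p) * hardyNorm p f := by
    rintro _ ⟨r, hr, rfl⟩
    exact Mp_cesaro_le hp ht0 ht1 hf hr
  exact ⟨⟨differentiableOn_cesaro ht0.le ht1 hf.1, ⟨_, hle⟩⟩,
    csSup_le ((nonempty_Ico.2 one_pos).image _) hle⟩
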